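/- Let μ be a probability measure on G = (ℤ/2ℤ)³ with a_max = μ({0}) and a_max > 1/4. Suppose there is a decomposition G = X₁ ⊕ X₂ (X₁ ∈ 𝔄₁, X₂ ∈ 𝔄₂, X₁ ∩ X₂ = {0}) such that condition II.3 holds: (a) there is a two-element subset E ⊆ X₂ such that μ(g + E) = μ(g + (X₂ \ E)) for both elements g ∈ X₁, and (b) for every subgroup K ∈ 𝔄₂ with K ≠ X₂, μ ∈ U(K) or μ ∈ U(K̄). Then μ ∈ TEC(G). -/

import Mathlib

open scoped BigOperators

/-- The group `G = (ℤ/2ℤ)³`. -/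
abbrev G : Type := ZMod 2 × ZMod 2 × ZMod 2

/-- The character pairing `(x,y) = (-1)^(x₁y₁+x₂y₂+x₃y₃)`. -/
noncomputable def pairing (x y : G) : ℝ :=
  (-1 : ℝ) ^ (x.1.val * y.1.val + x.2.1.val * y.2.1.val + x.2.2.val * y.2.2.val)

/-- A probability measure on `G`, given by its mass function. -/
def IsProb (p : G → ℝ) : Prop := (∀ x, 0 ≤ p x) ∧ ∑ x : G, p x = 1

/-- The characteristic function `μ̂(y) = Σ_x (x,y) μ({x})`. -/
noncomputable def charFn (p : G → ℝ) (y : G) : ℝ := ∑ x : G, pairing x y * p x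

/-- The measure of a set `E ⊆ G`. -/
noncomputable def measOf (p : G → ℝ) (E : Set G) : ℝ := ∑ x : G, E.indicator p x

/-- `μ` has a trivial equivalence class: every probability measure `ν` with
`|ν̂| = |μ̂|` is a shift `μₓ` of `μ` (central symmetry is the identity on `G`). -/
def TEC (p : G → ℝ) : Prop :=
  ∀ q : G → ℝ, IsProb q → (∀ y : G, |charFn q y| = |charFn p y|) →
    ∃ x : G, ∀ e : G, q e = p (e + x)

/-- `u(E) = max_{x ∈ E} μ({x})`. -/
noncomputable def uOf (p : G → ℝ) (E : Set G) : ℝ := sSup (p '' E)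

/-- `v(E) = min_{x ∈ E} μ({x})`. -/
noncomputable def vOf (p : G → ℝ) (E : Set G) : ℝ := sInf (p '' E)

/-- `μ ∈ U(E)` iff `2 u(E) > μ(E)`. -/
def USet (p : G → ℝ) (E : Set G) : Prop := measOf p E < 2 * uOf p E

/-- `μ ∈ V(E)` iff `1/2 + 2 v(E) < μ(E)`. -/
def VSet (p : G → ℝ) (E : Set G) : Prop := 1/2 + 2 * vOf p E < measOf p E

/-- The bilinear pairing on `G` with values in `ℤ/2ℤ`. -/
def dot (x y : G) : ZMod 2 := x.1 * y.1 + x.2.1 * y.2.1 + x.2.2 * y.2.2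

/-- The nontrivial real character of `ℤ/2ℤ`. -/
def signChar (t : ZMod 2) : ℝ := if t = 0 then 1 else -1

theorem signChar_zero : signChar 0 = 1 := by simp [signChar]

theorem signChar_one : signChar 1 = -1 := by simp [signChar]

theorem zmod_two_cases : ∀ t : ZMod 2, t = 0 ∨ t = 1 := by decide

theorem signChar_add (s t : ZMod 2) : signChar (s + t) = signChar s * signChar t := by
  have h : (1 : ZMod 2) + 1 = 0 := by decide
  rcases zmod_two_cases s with rfl | rfl <;> rcases zmod_two_cases t with rfl | rfl <;>
    simp [signChar_zero, signChar_one, h]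

theorem neg_one_pow_val (t : ZMod 2) : (-1 : ℝ) ^ t.val = signChar t := by
  rcases zmod_two_cases t with rfl | rfl
  · simp [signChar_zero]
  · simp [signChar_one, ZMod.val_one]

theorem pairing_eq (x y : G) : pairing x y = signChar (dot x y) := by
  have h : ∀ s t : ZMod 2, (-1 : ℝ) ^ (s.val * t.val) = signChar (s * t) := by
    intro s t
    rcases zmod_two_cases s with rfl | rfl
    · simp [signChar_zero]
    · simp [ZMod.val_one, neg_one_pow_val]
  simp only [pairing, dot, pow_add, signChar_add, h]

theorem dot_add_left (x y z : G) : dot (x + y) z = dot x z + dot y z := by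
  simp only [dot, Prod.fst_add, Prod.snd_add]; ring

theorem dot_add_right (x y z : G) : dot x (y + z) = dot x y + dot x z := by
  simp only [dot, Prod.fst_add, Prod.snd_add]; ring

theorem dot_comm (x y : G) : dot x y = dot y x := by
  simp only [dot]; ring

theorem dot_zero_left (x : G) : dot 0 x = 0 := by simp [dot]

theorem dot_zero_right (x : G) : dot x 0 = 0 := by simp [dot]

theorem add_self_zmod_two (x : G) : x + x = 0 := by revert x; decide

theorem add_add_cancel_self (x y : G) : x + (x + y) = y := by
  rw [← add_assoc, add_self_zmod_two, zero_add]

/-- Three elements of `G` that form a basis over `ℤ/2ℤ`. -/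
def IsBasis (a b c : G) : Prop :=
  a ≠ 0 ∧ b ≠ 0 ∧ a ≠ b ∧ c ≠ 0 ∧ c ≠ a ∧ c ≠ b ∧ c ≠ a + b

instance (a b c : G) : Decidable (IsBasis a b c) := by unfold IsBasis; infer_instance

set_option maxRecDepth 100000 in
set_option maxHeartbeats 4000000 in
theorem IsBasis.exists_dot : ∀ {a b c : G}, IsBasis a b c → ∀ i j k : ZMod 2,
    ∃ v : G, dot v a = i ∧ dot v b = j ∧ dot v c = k := by
  decide

set_option maxRecDepth 100000 in
set_option maxHeartbeats 4000000 in
theorem IsBasis.cases : ∀ {a b c : G}, IsBasis a b c → ∀ v : G,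
    v = 0 ∨ v = a ∨ v = b ∨ v = b + a ∨ v = c ∨ v = c + a ∨ v = c + b ∨ v = c + b + a := by
  decide

set_option maxRecDepth 100000 in
set_option maxHeartbeats 4000000 in
theorem IsBasis.univ_val : ∀ {a b c : G}, IsBasis a b c → (Finset.univ : Finset G).val =
    ({0, a, b, b + a, c, c + a, c + b, c + b + a} : Multiset G) := by
  decide

theorem IsBasis.sum_eq {a b c : G} (h : IsBasis a b c) (f : G → ℝ) :
    ∑ x : G, f x = f 0 + f a + f b + f (b + a) + f c + f (c + a) + f (c + b) + f (c + b + a) := by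
  rw [Finset.sum, h.univ_val]
  simp only [Multiset.insert_eq_cons, Multiset.map_cons, Multiset.sum_cons, Multiset.map_singleton,
    Multiset.sum_singleton]
  ring

theorem charFn_eq (p : G → ℝ) (v : G) : charFn p v = ∑ x : G, signChar (dot x v) * p x := by
  simp only [charFn, pairing_eq]

theorem charFn_zero (p : G → ℝ) : charFn p 0 = ∑ x : G, p x := by
  simp [charFn_eq, dot_zero_right, signChar_zero]

theorem exists_dot_eq_one : ∀ {x : G}, x ≠ 0 → ∃ v : G, dot x v = 1 := by decide

theorem sum_signChar_dot (x : G) : ∑ v : G, signChar (dot x v) = if x = 0 then 8 else 0 := by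
  split_ifs with h
  · subst h
    simp [dot_zero_left, signChar_zero]
  · obtain ⟨w, hw⟩ := exists_dot_eq_one h
    have hs := Equiv.sum_comp (Equiv.addRight w) fun v => signChar (dot x v)
    simp only [Equiv.coe_addRight, dot_add_right, signChar_add, hw, signChar_one, mul_neg, mul_one,
      Finset.sum_neg_distrib] at hs
    linarith

theorem fourier_inversion (p : G → ℝ) (e : G) :
    ∑ v : G, signChar (dot e v) * charFn p v = 8 * p e := by
  simp only [charFn_eq, Finset.mul_sum]
  rw [Finset.sum_comm]
  have h : ∀ x v : G, signChar (dot e v) * (signChar (dot x v) * p x)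
      = signChar (dot (e + x) v) * p x := by
    intro x v
    rw [dot_add_left, signChar_add, mul_assoc]
  have hx : ∀ x : G, e + x = 0 ↔ x = e := by
    intro x
    constructor
    · intro h
      rw [← add_add_cancel_self e x, h, add_zero]
    · rintro rfl
      exact add_self_zmod_two x
  simp only [h, ← Finset.sum_mul, sum_signChar_dot, hx]
  simp

theorem eq_shift_of_charFn {p q : G → ℝ} {x : G}
    (h : ∀ v, charFn q v = signChar (dot x v) * charFn p v) (e : G) : q e = p (e + x) := by
  have h₁ := fourier_inversion q e
  have h₂ := fourier_inversion p (e + x)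
  simp only [dot_add_left, signChar_add, mul_assoc, ← h] at h₂
  linarith

theorem eq_reflection_of_charFn {p q : G → ℝ} {x k : G} (hk : k ≠ 0)
    (h₀ : charFn q 0 = charFn p 0) (h₁ : charFn q k = signChar (dot x k) * charFn p k)
    (h : ∀ v, v ≠ 0 → v ≠ k → charFn q v = -(signChar (dot x v) * charFn p v)) (e : G) :
    8 * q e = 2 * charFn p 0 + 2 * signChar (dot (e + x) k) * charFn p k - 8 * p (e + x) := by
  have hv : ∀ v, signChar (dot e v) * charFn q v =
      (if v = 0 then 2 * charFn p 0 else 0)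
        + (if v = k then 2 * signChar (dot (e + x) k) * charFn p k else 0)
        - signChar (dot (e + x) v) * charFn p v := by
    intro v
    rw [dot_add_left, dot_add_left, signChar_add, signChar_add]
    by_cases hv₀ : v = 0
    · subst hv₀
      simp only [h₀, dot_zero_right, signChar_zero, if_true, if_neg hk.symm]
      ring
    by_cases hvk : v = k
    · subst hvk
      simp only [h₁, if_true, if_neg hv₀]
      ring
    simp only [h v hv₀ hvk, if_neg hv₀, if_neg hvk]
    ring
  rw [← fourier_inversion q e, ← fourier_inversion p (e + x), Finset.sum_congr rfl fun v _ => hv v,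
    Finset.sum_sub_distrib, Finset.sum_add_distrib, Finset.sum_ite_eq' Finset.univ 0,
    Finset.sum_ite_eq' Finset.univ k]
  simp

theorem two_mul_measOf (p : G → ℝ) (k : G) (i : ZMod 2) :
    2 * measOf p {g | dot g k = i} = charFn p 0 + signChar i * charFn p k := by
  rw [measOf, charFn_zero, charFn_eq, Finset.mul_sum, Finset.mul_sum, ← Finset.sum_add_distrib]
  refine Finset.sum_congr rfl fun g _ => ?_
  simp only [Set.indicator_apply, Set.mem_ofPred_eq]
  rcases zmod_two_cases i with rfl | rfl <;> rcases zmod_two_cases (dot g k) with h | h <;>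
    simp [h, signChar_zero, signChar_one] <;> ring

theorem not_uSet_of_charFn {p q : G → ℝ} (hq : ∀ e, 0 ≤ q e) {x k : G} (hk : k ≠ 0)
    (h₀ : charFn q 0 = charFn p 0) (h₁ : charFn q k = signChar (dot x k) * charFn p k)
    (h : ∀ v, v ≠ 0 → v ≠ k → charFn q v = -(signChar (dot x v) * charFn p v)) (i : ZMod 2) :
    ¬ USet p {g | dot g k = i} := by
  intro hU
  rw [USet] at hU
  rcases ({g : G | dot g k = i}).eq_empty_or_nonempty with hE | hE
  · simp [hE, measOf, uOf] at hU
  · obtain ⟨g, hg, hgu⟩ := (hE.image p).csSup_mem (Set.toFinite _)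
    rw [uOf, ← hgu] at hU
    have hr := eq_reflection_of_charFn hk h₀ h₁ h (g + x)
    have hm := two_mul_measOf p k i
    rw [add_assoc, add_self_zmod_two, add_zero, Set.mem_ofPred_eq.mp hg] at hr
    have := hq (g + x)
    linarith

/-- The kernel of the character of `G` given by `k`. -/
def dotKer (k : G) : AddSubgroup G where
  carrier := {g | dot g k = 0}
  add_mem' := by
    intro a b ha hb
    rw [Set.mem_ofPred_eq] at *
    rw [dot_add_left, ha, hb, add_zero]
  zero_mem' := dot_zero_left k
  neg_mem' := by
    intro a ha
    rwa [neg_eq_of_add_eq_zero_left (add_self_zmod_two a)]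

theorem coe_dotKer (k : G) : (dotKer k : Set G) = {g | dot g k = 0} := rfl

theorem compl_coe_dotKer (k : G) : (dotKer k : Set G)ᶜ = {g | dot g k = 1} := by
  ext g
  rw [coe_dotKer, Set.mem_compl_iff, Set.mem_ofPred_eq, Set.mem_ofPred_eq]
  rcases zmod_two_cases (dot g k) with h | h <;> simp [h]

theorem card_dotKer {k : G} (hk : k ≠ 0) : Nat.card (dotKer k) = 4 := by
  have h : ∀ {k : G}, k ≠ 0 → (Finset.univ.filter fun g : G => dot g k = 0).card = 4 := by decide
  rw [← h hk, ← Set.ncard_coe_finset, ← Nat.card_coe_set_eq]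
  simp [← coe_dotKer]

theorem charFn_eq_zero_of_balanced {p : G → ℝ} {a b c e v : G} (h : IsBasis a b c)
    (he : p e + p (e + a) = p (e + b) + p (e + (b + a)))
    (hc : p (e + c) + p (e + (c + a)) = p (e + (c + b)) + p (e + (c + b + a)))
    (ha : dot v a = 0) (hb : dot v b = 1) : charFn p v = 0 := by
  have hs := Equiv.sum_comp (Equiv.addLeft e) fun x => signChar (dot x v) * p x
  rw [charFn_eq, ← hs, h.sum_eq]
  rw [dot_comm] at ha hb
  simp only [Equiv.coe_addLeft, dot_add_left, signChar_add, ha, hb, signChar_one, add_zero]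
  linear_combination signChar (dot e v) * he + signChar (dot e v) * signChar (dot c v) * hc

theorem exists_signChar_mul_eq {r s : ℝ} (h : |r| = |s|) : ∃ t : ZMod 2, r = signChar t * s := by
  rcases abs_eq_abs.mp h with h | h
  · exact ⟨0, by rw [signChar_zero, one_mul, h]⟩
  · exact ⟨1, by rw [signChar_one, neg_one_mul, h]⟩

theorem exists_shift_of_abs_charFn_eq {p q : G → ℝ} (hp : IsProb p) (hq : IsProb q) {z y w : G}
    (hb : IsBasis z y w) (hy : charFn p y = 0) (hyz : charFn p (y + z) = 0)
    (hU : ∀ k, k ≠ 0 → k ≠ z → ∃ i, USet p {g | dot g k = i})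
    (habs : ∀ v, |charFn q v| = |charFn p v|) : ∃ x : G, ∀ e : G, q e = p (e + x) := by
  choose t ht using fun v => exists_signChar_mul_eq (habs v)
  have h₀ : charFn q 0 = charFn p 0 := by rw [charFn_zero, charFn_zero, hp.2, hq.2]
  have hshift : ∀ x, (∀ v, v = 0 ∨ charFn p v = 0 ∨ t v = dot x v) →
      ∃ x : G, ∀ e : G, q e = p (e + x) := by
    refine fun x hx => ⟨x, eq_shift_of_charFn fun v => ?_⟩
    rcases hx v with rfl | h | h
    · rw [h₀, dot_zero_right, signChar_zero, one_mul]
    · rw [ht, h, mul_zero, mul_zero]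
    · rw [ht, h]
  have hrefl : ∀ k x, k ≠ 0 → k ≠ z → (charFn p k = 0 ∨ t k = dot x k) →
      (∀ v, v = 0 ∨ v = k ∨ charFn p v = 0 ∨ t v = dot x v + 1) → False := by
    intro k x hk hkz hxk hx
    obtain ⟨i, hi⟩ := hU k hk hkz
    refine not_uSet_of_charFn hq.1 (x := x) hk h₀ ?_ ?_ i hi
    · rcases hxk with h | h
      · rw [ht, h, mul_zero, mul_zero]
      · rw [ht, h]
    · intro v hv hvk
      rcases hx v with h | h | h | h
      · exact absurd h hv
      · exact absurd h hvk
      · rw [ht, h, mul_zero, mul_zero, neg_zero]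
      · rw [ht, h, signChar_add, signChar_one, mul_neg_one, neg_mul]
  have hwy : w + y ≠ 0 := fun h => hb.2.2.2.2.2.1 (by
    rw [← add_add_cancel_self y w, add_comm y w, h, add_zero])
  have hwyz : w + y ≠ z := fun h => hb.2.2.2.2.2.2 (by
    rw [← h, add_assoc, add_self_zmod_two, add_zero])
  have htwo : ∀ s : ZMod 2, s + s = 0 := by decide
  rcases zmod_two_cases (t (w + z) + t z + t w) with hA | hA <;>
    rcases zmod_two_cases (t (w + y + z) + t z + t (w + y)) with hB | hB
  · obtain ⟨x, hz, hy', hw⟩ := hb.exists_dot (t z) (t (w + y) + t w) (t w)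
    refine hshift x fun v => ?_
    rcases hb.cases v with rfl | rfl | rfl | rfl | rfl | rfl | rfl | rfl <;>
      simp only [dot_add_right, hz, hy', hw] <;> grind
  · obtain ⟨x, hz, hy', hw⟩ := hb.exists_dot (t z + 1) (t (w + y) + t w + 1) (t w)
    refine (hrefl w x hb.2.2.2.1 hb.2.2.2.2.1 (.inr hw.symm) fun v => ?_).elim
    rcases hb.cases v with rfl | rfl | rfl | rfl | rfl | rfl | rfl | rfl <;>
      simp only [dot_add_right, hz, hy', hw] <;> grind
  · obtain ⟨x, hz, hy', hw⟩ := hb.exists_dot (t z + 1) (t (w + y) + t w + 1) (t w + 1)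
    refine (hrefl (w + y) x hwy hwyz (.inr ?_) fun v => ?_).elim
    · rw [dot_add_right, hy', hw]
      grind
    rcases hb.cases v with rfl | rfl | rfl | rfl | rfl | rfl | rfl | rfl <;>
      simp only [dot_add_right, hz, hy', hw] <;> grind
  · obtain ⟨x, hz, hy', hw⟩ := hb.exists_dot (t z + 1) (t (w + y) + t w) (t w + 1)
    refine (hrefl y x hb.2.1 hb.2.2.1.symm (.inl hy) fun v => ?_).elim
    rcases hb.cases v with rfl | rfl | rfl | rfl | rfl | rfl | rfl | rfl <;>
      simp only [dot_add_right, hz, hy', hw] <;> grind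

theorem measOf_pair (p : G → ℝ) {x y : G} (h : x ≠ y) : measOf p {x, y} = p x + p y := by
  rw [measOf, ← Finset.sum_pair h, Finset.sum_indicator_eq_sum_filter]
  congr 1
  ext; simp

theorem measOf_image_pair (p : G → ℝ) (g : G) {x y : G} (h : x ≠ y) :
    measOf p ((g + ·) '' {x, y}) = p (g + x) + p (g + y) := by
  rw [Set.image_pair, measOf_pair p fun hg => h (add_left_cancel hg)]

/-- A balanced pair in a subgroup of order four, written in terms of a basis of `G`. -/
theorem exists_basis_of_balanced {p : G → ℝ} {X₁ X₂ : AddSubgroup G} (hX₁ : Nat.card X₁ = 2)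
    (hX₂ : Nat.card X₂ = 4) (hinf : X₁ ⊓ X₂ = ⊥)
    (hE : ∃ E ⊆ (X₂ : Set G), E.ncard = 2 ∧
      ∀ g ∈ X₁, measOf p ((g + ·) '' E) = measOf p ((g + ·) '' ((X₂ : Set G) \ E))) :
    ∃ a b c e, IsBasis a b c ∧ a ∈ X₂ ∧ b ∈ X₂ ∧
      p e + p (e + a) = p (e + b) + p (e + (b + a)) ∧
      p (e + c) + p (e + (c + a)) = p (e + (c + b)) + p (e + (c + b + a)) := by
  obtain ⟨E, hEX, hEc, hEm⟩ := hE
  have hcard : ((X₂ : Set G) \ E).ncard = 2 := by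
    have h := Set.ncard_sdiff hEX
    have hX : (X₂ : Set G).ncard = 4 := by rw [← Nat.card_coe_set_eq]; exact hX₂
    omega
  obtain ⟨x, y, hxy, rfl⟩ := Set.ncard_eq_two.mp hEc
  obtain ⟨u, v, huv, hF⟩ := Set.ncard_eq_two.mp hcard
  have hx : x ∈ X₂ := hEX (by simp)
  have hy : y ∈ X₂ := hEX (by simp)
  have hu : u ∈ (X₂ : Set G) \ {x, y} := by rw [hF]; simp
  have huX : u ∈ X₂ := hu.1
  have hux : u ≠ x := fun h => hu.2 (by simp [h])
  have huy : u ≠ y := fun h => hu.2 (by simp [h])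
  have hzero : ∀ {r s : G}, r + s = 0 → r = s := by
    intro r s h
    rw [← add_add_cancel_self s r, add_comm s r, h, add_zero]
  have hv : v = x + ((x + u) + (x + y)) := by
    have h₁ : x + ((x + u) + (x + y)) = u + (x + y) := by rw [add_assoc, add_add_cancel_self]
    rw [h₁]
    have hmem : u + (x + y) ∈ ({u, v} : Set G) := by
      rw [← hF]
      refine ⟨X₂.add_mem huX (X₂.add_mem hx hy), ?_⟩
      rintro (h | h)
      · rw [add_left_comm] at h
        exact huy (hzero (add_eq_left.mp h))
      · rw [Set.mem_singleton_iff, ← add_assoc] at h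
        exact hux (hzero (add_eq_right.mp h))
    rcases hmem with h | h
    · exact absurd (hzero (add_eq_left.mp h)) hxy
    · exact h.symm
  obtain ⟨c, hcX, hc⟩ : ∃ c ∈ X₁, c ≠ 0 := by
    by_contra! h
    rw [(AddSubgroup.eq_bot_iff_forall X₁).mpr h] at hX₁
    simp at hX₁
  have hcX₂ : c ∉ X₂ := fun h => hc (by
    rw [← AddSubgroup.mem_bot, ← hinf]
    exact ⟨hcX, h⟩)
  have ha : x + y ∈ X₂ := X₂.add_mem hx hy
  have hb : x + u ∈ X₂ := X₂.add_mem hx huX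
  have h₀ := hEm 0 X₁.zero_mem
  have h₁ := hEm c hcX
  rw [hF, measOf_image_pair p _ hxy, measOf_image_pair p _ huv] at h₀ h₁
  refine ⟨x + y, x + u, c, x, ⟨fun h => hxy (hzero h), fun h => hux (hzero h).symm,
    fun h => huy (add_left_cancel h).symm, hc, fun h => hcX₂ (h ▸ ha), fun h => hcX₂ (h ▸ hb),
    fun h => hcX₂ (h ▸ X₂.add_mem ha hb)⟩, ha, hb, ?_, ?_⟩
  · rw [← hv, add_add_cancel_self, add_add_cancel_self]
    simpa only [zero_add] using h₀
  · have h₂ : x + (c + (x + u) + (x + y)) = c + v := by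
      rw [hv, add_assoc c, add_left_comm]
    rw [h₂, add_left_comm x c, add_left_comm x c, add_add_cancel_self, add_add_cancel_self,
      add_comm x c]
    exact h₁

/-- `a_max = μ({0}) > 1/4`, with a decomposition `G = X₁ ⊕ X₂` satisfying
condition II.3, implies `μ ∈ TEC(G)`. -/
theorem stmt5 (p : G → ℝ) (hp : IsProb p)
    (hmax : ∀ x : G, p x ≤ p 0) (hgt : 1/4 < p 0)
    (X₁ X₂ : AddSubgroup G) (hX₁ : Nat.card X₁ = 2) (hX₂ : Nat.card X₂ = 4)
    (hinf : X₁ ⊓ X₂ = ⊥) (hsup : X₁ ⊔ X₂ = ⊤)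
    (hII3a : ∃ E ⊆ (X₂ : Set G), E.ncard = 2 ∧
      ∀ g ∈ X₁, measOf p ((g + ·) '' E) = measOf p ((g + ·) '' ((X₂ : Set G) \ E)))
    (hII3b : ∀ K : AddSubgroup G, Nat.card K = 4 → K ≠ X₂ →
      USet p (K : Set G) ∨ USet p ((K : Set G))ᶜ) :
    TEC p := by
  intro q hq habs
  obtain ⟨a, b, c, e, h, ha, hb, he, hc⟩ := exists_basis_of_balanced hX₁ hX₂ hinf hII3a
  obtain ⟨z, hza, hzb, hzc⟩ := h.exists_dot 0 0 1
  obtain ⟨y, hya, hyb, hyc⟩ := h.exists_dot 0 1 0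
  obtain ⟨w, hwa, hwb, hwc⟩ := h.exists_dot 1 0 0
  have hbasis : IsBasis z y w := by
    refine ⟨?_, ?_, ?_, ?_, ?_, ?_, ?_⟩ <;> rintro rfl <;>
      simp_all [dot_zero_left, dot_add_left]
  refine exists_shift_of_abs_charFn_eq hp hq hbasis
    (charFn_eq_zero_of_balanced h he hc hya hyb)
    (charFn_eq_zero_of_balanced h he hc (by simp [dot_add_left, hya, hza])
      (by simp [dot_add_left, hyb, hzb])) (fun k hk hkz => ?_) habs
  have hne : dotKer k ≠ X₂ := by
    rintro rfl
    have hka : dot k a = 0 := (dot_comm k a).trans ha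
    have hkb : dot k b = 0 := (dot_comm k b).trans hb
    rcases hbasis.cases k with rfl | rfl | rfl | rfl | rfl | rfl | rfl | rfl <;>
      simp_all [dot_add_left]
  rcases hII3b (dotKer k) (card_dotKer hk) hne with hU | hU
  · exact ⟨0, by rwa [coe_dotKer] at hU⟩
  · exact ⟨1, by rwa [compl_coe_dotKer] at hU⟩
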